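/- Fix ε > 0, κ > 0, m ≥ 2, μ > 0 and c ∈ ℝ. On {x ∈ ℝ³ : x' ≠ 0} define δ(x') = ε + 2κ|x'|^m, ∂₁δ(x') = 2κm|x'|^{m−2}x1, and the 3×3 matrix field S̄⁽¹⁾(x) with entries S̄⁽¹⁾₁₃ = S̄⁽¹⁾₃₁ = μc/δ(x'), S̄⁽¹⁾₃₃ = μc x3 ∂₁δ(x')/δ(x')², and all other entries zero. Then S̄⁽¹⁾ is symmetric and divergence-free at every such point, i.e. Σ_{l=1}^{3} ∂_l S̄⁽¹⁾_{kl}(x) = 0 for k = 1, 2, 3. -/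

import Mathlib

open Matrix

/-- Gap width `δ(x') = ε + 2κ|x'|^m`. -/
noncomputable def δf (ε κ m x1 x2 : ℝ) : ℝ := ε + 2 * κ * Real.sqrt (x1 ^ 2 + x2 ^ 2) ^ m

/-- `∂₁δ(x') = 2κm|x'|^{m−2}x₁`. -/
noncomputable def d1δ (κ m x1 x2 : ℝ) : ℝ :=
  2 * κ * m * Real.sqrt (x1 ^ 2 + x2 ^ 2) ^ (m - 2) * x1

lemma δf_pos {ε κ : ℝ} (hε : 0 < ε) (hκ : 0 < κ) (m x1 x2 : ℝ) : 0 < δf ε κ m x1 x2 := by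
  unfold δf
  positivity

lemma hasDerivAt_δf (ε κ m : ℝ) {x1 x2 : ℝ} (hx : (x1, x2) ≠ (0, 0)) :
    HasDerivAt (fun t => δf ε κ m t x2) (d1δ κ m x1 x2) x1 := by
  have hpos : 0 < x1 ^ 2 + x2 ^ 2 := by
    by_contra! h
    exact hx (Prod.ext (by nlinarith [sq_nonneg x1, sq_nonneg x2])
      (by nlinarith [sq_nonneg x1, sq_nonneg x2]))
  have hr : 0 < Real.sqrt (x1 ^ 2 + x2 ^ 2) := Real.sqrt_pos.mpr hpos
  have hsq : HasDerivAt (fun t : ℝ => t ^ 2 + x2 ^ 2) (2 * x1) x1 := by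
    simpa using (hasDerivAt_pow 2 x1).add_const (x2 ^ 2)
  have h := (((hsq.sqrt hpos.ne').rpow_const (p := m) (Or.inl hr.ne')).const_mul
    (2 * κ)).const_add ε
  refine h.congr_deriv ?_
  have hpow : Real.sqrt (x1 ^ 2 + x2 ^ 2) ^ (m - 1)
      = Real.sqrt (x1 ^ 2 + x2 ^ 2) ^ (m - 2) * Real.sqrt (x1 ^ 2 + x2 ^ 2) := by
    rw [← Real.rpow_add_one hr.ne']
    ring_nf
  rw [hpow, d1δ]
  field_simp

/-- The explicit shear test stress tensor
`S̄⁽¹⁾₁₃ = S̄⁽¹⁾₃₁ = μc/δ`, `S̄⁽¹⁾₃₃ = μcx₃∂₁δ/δ²`, other entries zero,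
is symmetric and row-wise divergence free away from `x' = 0`. -/
theorem stmt11 (ε κ m μ c : ℝ) (hε : 0 < ε) (hκ : 0 < κ) (hm : 2 ≤ m) (hμ : 0 < μ)
    (S : ℝ → ℝ → ℝ → Matrix (Fin 3) (Fin 3) ℝ)
    (hS : ∀ x1 x2 x3 : ℝ, S x1 x2 x3 =
      !![0, 0, μ * c / δf ε κ m x1 x2;
         0, 0, 0;
         μ * c / δf ε κ m x1 x2, 0,
           μ * c * x3 * d1δ κ m x1 x2 / (δf ε κ m x1 x2) ^ 2]) :
    ∀ x1 x2 x3 : ℝ, (x1, x2) ≠ (0, 0) →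
      (S x1 x2 x3).IsSymm ∧
      ∀ k : Fin 3,
        deriv (fun t => S t x2 x3 k 0) x1 + deriv (fun t => S x1 t x3 k 1) x2
          + deriv (fun t => S x1 x2 t k 2) x3 = 0 := by
  intro x1 x2 x3 hx
  refine ⟨?_, fun k => ?_⟩
  · rw [hS]
    ext i j
    fin_cases i <;> fin_cases j <;> rfl
  · have hδ := (δf_pos hε hκ m x1 x2).ne'
    have h1 : HasDerivAt (fun t => μ * c / δf ε κ m t x2)
        (-(μ * c * d1δ κ m x1 x2) / δf ε κ m x1 x2 ^ 2) x1 := by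
      refine ((hasDerivAt_const x1 (μ * c)).div (hasDerivAt_δf ε κ m hx) hδ).congr_deriv ?_
      ring
    have h3 : HasDerivAt (fun t => μ * c * t * d1δ κ m x1 x2 / δf ε κ m x1 x2 ^ 2)
        (μ * c * d1δ κ m x1 x2 / δf ε κ m x1 x2 ^ 2) x3 := by
      simpa using ((((hasDerivAt_id x3).const_mul (μ * c)).mul_const
        (d1δ κ m x1 x2)).div_const (δf ε κ m x1 x2 ^ 2))
    fin_cases k
    · simp [hS]
    · simp [hS]
    · simp only [hS]
      simp [h1.deriv, h3.deriv]
      ring
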